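/- Let a state of PIF satisfy RP'(k) for some 1 ≤ k ≤ N−1. Then at least one action is enabled (back at p_k when k ≥ 2, clear when k = 1), and the execution of any enabled action yields a state satisfying RP'(k) or RP'(k−1), or (when k = 1 and clear is executed) a state satisfying RQ'(0,1). -/

import Mathlib

/-- Values of the state variable of a PIF process: idle, requesting, replying. -/
inductive PSt where
  | idle | rq | rp
deriving DecidableEq

/-- A PIF state on the chain of `N` processes is valid if the root (process 1)
never holds `rp` and the leaf (process `N`) never holds `rq`. -/
def PifValid (N : ℕ) (st : ℕ → PSt) : Prop := st 1 ≠ PSt.rp ∧ st N ≠ PSt.rq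

/-- One step of the PIF program on the chain of `N` processes: `st'` is
obtained from `st` by executing one enabled action (request, clear, forward,
back, stop, reflect or reset). -/
def pifStep (N : ℕ) (st st' : ℕ → PSt) : Prop :=
  -- request (root)
  (st 1 = PSt.idle ∧ st 2 = PSt.idle ∧ st' = Function.update st 1 PSt.rq) ∨
  -- clear (root)
  (st 1 = PSt.rq ∧ st 2 = PSt.rp ∧ st' = Function.update st 1 PSt.idle) ∨
  -- forward (intermediate)
  (∃ j, 2 ≤ j ∧ j ≤ N - 1 ∧ st (j - 1) = PSt.rq ∧ st j = PSt.idle ∧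
    st (j + 1) = PSt.idle ∧ st' = Function.update st j PSt.rq) ∨
  -- back (intermediate)
  (∃ j, 2 ≤ j ∧ j ≤ N - 1 ∧ st (j - 1) = PSt.rq ∧ st j = PSt.rq ∧
    st (j + 1) = PSt.rp ∧ st' = Function.update st j PSt.rp) ∨
  -- stop (intermediate)
  (∃ j, 2 ≤ j ∧ j ≤ N - 1 ∧ st (j - 1) = PSt.idle ∧ st j ≠ PSt.idle ∧
    st' = Function.update st j PSt.idle) ∨
  -- reflect (leaf)
  (st (N - 1) = PSt.rq ∧ st N = PSt.idle ∧ st' = Function.update st N PSt.rp) ∨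
  -- reset (leaf)
  (st (N - 1) = PSt.idle ∧ st N = PSt.rp ∧ st' = Function.update st N PSt.idle)

/-- `RP N k st`: the `k` leftmost processes are requesting and the rest are
replying (`1 ≤ k ≤ N - 1`). -/
def RP (N k : ℕ) (st : ℕ → PSt) : Prop :=
  1 ≤ k ∧ k ≤ N - 1 ∧
  (∀ j, 1 ≤ j → j ≤ k → st j = PSt.rq) ∧
  (∀ j, k < j → j ≤ N → st j = PSt.rp)

/-- `RQ N l m st`: the `l` leftmost processes are requesting, processes
`l+1 .. m` are idle, and the rest are replying (`0 ≤ l < m ≤ N`). -/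
def RQ (N l m : ℕ) (st : ℕ → PSt) : Prop :=
  l < m ∧ m ≤ N ∧
  (∀ j, 1 ≤ j → j ≤ l → st j = PSt.rq) ∧
  (∀ j, l < j → j ≤ m → st j = PSt.idle) ∧
  (∀ j, m < j → j ≤ N → st j = PSt.rp)

/-- `RP' N k st`: the `k` leftmost processes are requesting, process `k+1` is
replying, and no process beyond `k+1` is idle (`1 ≤ k ≤ N - 1`). -/
def RP' (N k : ℕ) (st : ℕ → PSt) : Prop :=
  1 ≤ k ∧ k ≤ N - 1 ∧
  (∀ j, 1 ≤ j → j ≤ k → st j = PSt.rq) ∧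
  st (k + 1) = PSt.rp ∧
  (∀ j, k + 1 < j → j ≤ N → st j ≠ PSt.idle)

/-- `RQ' N l m st`: the `l` leftmost processes are requesting, processes
`l+1 .. m` are idle, and the remaining processes are arbitrary
(`0 ≤ l < m ≤ N`). -/
def RQ' (N l m : ℕ) (st : ℕ → PSt) : Prop :=
  l < m ∧ m ≤ N ∧
  (∀ j, 1 ≤ j → j ≤ l → st j = PSt.rq) ∧
  (∀ j, l < j → j ≤ m → st j = PSt.idle)

/-- From a state satisfying `RP' k` (`1 ≤ k ≤ N-1`) at least one action is
enabled (`back` at process `k` when `k ≥ 2`, `clear` when `k = 1`), and any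
enabled action yields a state satisfying `RP' k` or `RP' (k-1)`, or (when
`k = 1`, via `clear`) a state satisfying `RQ' 0 1`. -/
theorem pif_rp'_progress (N : ℕ) (hN : 3 ≤ N)
    (st : ℕ → PSt) (hv : PifValid N st)
    (k : ℕ) (h : RP' N k st) :
    (2 ≤ k → pifStep N st (Function.update st k PSt.rp)) ∧
    (k = 1 → pifStep N st (Function.update st 1 PSt.idle)) ∧
    (∃ st', pifStep N st st') ∧
    (∀ st', pifStep N st st' →
      RP' N k st' ∨ RP' N (k - 1) st' ∨
      (k = 1 ∧ st' = Function.update st 1 PSt.idle ∧ RQ' N 0 1 st')) := by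
  obtain ⟨hk1, hkN, hrq, hrp, hni⟩ := h
  have hne : ∀ j, 1 ≤ j → j ≤ N → st j ≠ PSt.idle := by
    intro j h1 h2 h3
    rcases lt_trichotomy j (k + 1) with hj | hj | hj
    · have := hrq j h1 (by omega)
      rw [h3] at this; cases this
    · subst hj
      rw [h3] at hrp; cases hrp
    · exact hni j hj h2 h3
  have hback : 2 ≤ k → pifStep N st (Function.update st k PSt.rp) := by
    intro h2
    exact Or.inr (Or.inr (Or.inr (Or.inl ⟨k, h2, hkN, hrq _ (by omega) (by omega),
      hrq _ hk1 le_rfl, hrp, rfl⟩)))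
  have hclear : k = 1 → pifStep N st (Function.update st 1 PSt.idle) := by
    intro h1
    subst h1
    exact Or.inr (Or.inl ⟨hrq 1 le_rfl le_rfl, hrp, rfl⟩)
  refine ⟨hback, hclear, ?_, ?_⟩
  · rcases Nat.lt_or_ge k 2 with h2 | h2
    · exact ⟨_, hclear (by omega)⟩
    · exact ⟨_, hback h2⟩
  · rintro st' (⟨h1, -, -⟩ | ⟨-, h2, rfl⟩ | ⟨j, hj2, hjN, -, h1, -, -⟩ |
      ⟨j, hj2, hjN, hj, hjq, hjp, rfl⟩ | ⟨j, hj2, hjN, h1, -, -⟩ | ⟨-, h1, -⟩ | ⟨h1, -, -⟩)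
    · exact absurd h1 (hne 1 le_rfl (by omega))
    · have hk : k = 1 := by
        by_contra hc
        have := hrq 2 (by omega) (by omega)
        rw [h2] at this; cases this
      refine Or.inr (Or.inr ⟨hk, rfl, by omega, by omega, fun j _ _ => by omega, fun j _ _ => ?_⟩)
      obtain rfl : j = 1 := by omega
      simp
    · exact absurd h1 (hne j (by omega) (by omega))
    · rcases lt_trichotomy j k with hlt | rfl | hgt
      · have := hrq (j + 1) (by omega) (by omega)
        rw [hjp] at this; cases this
      · refine Or.inr (Or.inl ⟨by omega, by omega, fun i _ _ => ?_, ?_, fun i _ _ => ?_⟩)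
        · rw [Function.update_of_ne (by omega)]
          exact hrq i (by omega) (by omega)
        · rw [Nat.sub_add_cancel hk1]
          simp
        · rw [Function.update_of_ne (by omega)]
          exact hne i (by omega) (by omega)
      · have hjk : j ≠ k + 1 := by
          rintro rfl
          rw [hrp] at hjq; cases hjq
        refine Or.inl ⟨hk1, hkN, fun i _ _ => ?_, ?_, fun i _ _ => ?_⟩
        · rw [Function.update_of_ne (by omega)]
          exact hrq i (by omega) (by omega)
        · rw [Function.update_of_ne (by omega)]
          exact hrp
        · by_cases hij : i = j
          · subst hij
            simp
          · rw [Function.update_of_ne hij]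
            exact hne i (by omega) (by omega)
    · exact absurd h1 (hne (j - 1) (by omega) (by omega))
    · exact absurd h1 (hne N (by omega) le_rfl)
    · exact absurd h1 (hne (N - 1) (by omega) (by omega))
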